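/- Let X = ℝⁿ, n ≥ 2, with κ the α-Riesz kernel of order α ∈ (0, n) with α ≤ 2. Let A ⊆ ℝⁿ be such that E⁺(A) is closed in the strong metric d, cap_*(A) > 0, and A is not inner α-thin at infinity (which forces cap_*(A) = ∞), and let f := −U^ζ where ζ ∈ E⁺ and ζ(ℝⁿ) ≤ 1. Then the solution λ_{A,f} of the inner Gauss variational problem for (A, f) exists if and only if ζ(ℝⁿ) = 1, and in the affirmative case λ_{A,f} = ζ^A. -/

import Mathlib

open MeasureTheory Topology Filter Set ENNReal

noncomputable section

namespace GaussVar

variable {X : Type*} [TopologicalSpace X] [MeasurableSpace X]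

/-- A (positive) Radon measure: a regular Borel measure. -/
def IsRadon (μ : Measure X) : Prop := μ.Regular

/-- The mutual energy `I(μ,ν) = ∬ κ(x,y) d(μ⊗ν)(x,y)`. -/
def mutualEnergy (κ : X → X → ℝ≥0∞) (μ ν : Measure X) : ℝ≥0∞ :=
  ∫⁻ p : X × X, κ p.1 p.2 ∂(μ.prod ν)

/-- The energy `I(μ) := I(μ,μ)`. -/
def energy (κ : X → X → ℝ≥0∞) (μ : Measure X) : ℝ≥0∞ := mutualEnergy κ μ μ

/-- Membership in the cone `E⁺` of Radon measures with finite energy. -/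
def memEplus (κ : X → X → ℝ≥0∞) (μ : Measure X) : Prop :=
  IsRadon μ ∧ energy κ μ < ⊤

/-- A kernel: symmetric and lower semicontinuous with values in `[0,∞]`. -/
def IsKernel (κ : X → X → ℝ≥0∞) : Prop :=
  (∀ x y, κ x y = κ y x) ∧ LowerSemicontinuous (fun p : X × X => κ p.1 p.2)

/-- The strong (energy) metric `d(μ,ν) := (I(μ)+I(ν)−2I(μ,ν))^{1/2}` on `E⁺`. -/
def strongDist (κ : X → X → ℝ≥0∞) (μ ν : Measure X) : ℝ :=
  Real.sqrt ((energy κ μ).toReal + (energy κ ν).toReal - 2 * (mutualEnergy κ μ ν).toReal)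

/-- The energy principle (strict positive definiteness). -/
def EnergyPrinciple (κ : X → X → ℝ≥0∞) : Prop :=
  ∀ μ ν : Measure X, memEplus κ μ → memEplus κ ν →
    2 * mutualEnergy κ μ ν ≤ energy κ μ + energy κ ν ∧
      (2 * mutualEnergy κ μ ν = energy κ μ + energy κ ν → μ = ν)

/-- Convergence of a sequence in the strong metric. -/
def StrongTendstoSeq (κ : X → X → ℝ≥0∞) (μ : ℕ → Measure X) (μ₀ : Measure X) : Prop :=
  Tendsto (fun n => strongDist κ (μ n) μ₀) atTop (𝓝 0)

/-- Vague convergence of a sequence of measures. -/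
def VagueTendstoSeq (μ : ℕ → Measure X) (μ₀ : Measure X) : Prop :=
  ∀ φ : X → ℝ, Continuous φ → HasCompactSupport φ →
    Tendsto (fun n => ∫ x, φ x ∂(μ n)) atTop (𝓝 (∫ x, φ x ∂μ₀))

/-- Cauchy sequence in the strong metric. -/
def StrongCauchySeq (κ : X → X → ℝ≥0∞) (μ : ℕ → Measure X) : Prop :=
  ∀ ε : ℝ, 0 < ε → ∃ N : ℕ, ∀ m ≥ N, ∀ n ≥ N, strongDist κ (μ m) (μ n) < ε

/-- A perfect kernel: satisfies the energy principle, `(E⁺,d)` is complete, and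
strong convergence implies vague convergence. -/
def IsPerfect (κ : X → X → ℝ≥0∞) : Prop :=
  EnergyPrinciple κ ∧
    (∀ μ : ℕ → Measure X, (∀ n, memEplus κ (μ n)) → StrongCauchySeq κ μ →
        ∃ μ₀ : Measure X, memEplus κ μ₀ ∧ StrongTendstoSeq κ μ μ₀) ∧
    (∀ (μ : ℕ → Measure X) (μ₀ : Measure X), (∀ n, memEplus κ (μ n)) → memEplus κ μ₀ →
        StrongTendstoSeq κ μ μ₀ → VagueTendstoSeq μ μ₀)

/-- `μ` is concentrated on `A`: the complement of `A` is locally `μ`-negligible. -/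
def Concentrated (μ : Measure X) (A : Set X) : Prop :=
  ∀ K : Set X, IsCompact K → μ (Aᶜ ∩ K) = 0

/-- Membership in `Ĕ⁺(A)`: finite-energy Radon measures concentrated on `A`
of unit total mass. -/
def memBreve (κ : X → X → ℝ≥0∞) (A : Set X) (μ : Measure X) : Prop :=
  memEplus κ μ ∧ Concentrated μ A ∧ μ Set.univ = 1

/-- `w(A) := inf { I(μ) : μ ∈ Ĕ⁺(A) }` (with `inf ∅ = ⊤`). -/
def wcap (κ : X → X → ℝ≥0∞) (A : Set X) : ℝ≥0∞ :=
  ⨅ (μ : Measure X) (_ : memBreve κ A μ), energy κ μ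

/-- The inner capacity `cap_*(A) := 1 / w(A)`. -/
def innerCap (κ : X → X → ℝ≥0∞) (A : Set X) : ℝ≥0∞ := (wcap κ A)⁻¹

/-- The outer capacity `cap^*(E) := inf { cap_*(D) : D open, E ⊆ D }`. -/
def outerCap (κ : X → X → ℝ≥0∞) (E : Set X) : ℝ≥0∞ :=
  ⨅ (D : Set X) (_ : IsOpen D ∧ E ⊆ D), innerCap κ D

/-- `P` holds nearly everywhere (n.e.) on `A`: the exceptional subset of `A`
has inner capacity zero. -/
def NearlyEverywhere (κ : X → X → ℝ≥0∞) (A : Set X) (P : X → Prop) : Prop :=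
  innerCap κ {x ∈ A | ¬ P x} = 0

/-- The potential `U^μ(x) := ∫ κ(x,y) dμ(y)`. -/
def potential (κ : X → X → ℝ≥0∞) (μ : Measure X) (x : X) : ℝ≥0∞ :=
  ∫⁻ y, κ x y ∂μ

/-- An external field: `f = ψ + U^{ϑ⁺} − U^{ϑ⁻}` where `ψ` is lower semicontinuous,
`(−∞,∞]`-valued, positive if `X` is noncompact, and `ϑ⁺, ϑ⁻ ∈ E⁺`. -/
def IsExternalField (κ : X → X → ℝ≥0∞) (f : X → EReal) : Prop :=
  ∃ (ψ : X → EReal) (ϑp ϑm : Measure X),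
    LowerSemicontinuous ψ ∧ (∀ x, ψ x ≠ ⊥) ∧ (¬ CompactSpace X → ∀ x, 0 ≤ ψ x) ∧
    memEplus κ ϑp ∧ memEplus κ ϑm ∧
    ∀ x, f x = ψ x + (potential κ ϑp x : EReal) - (potential κ ϑm x : EReal)

/-- `f` is `μ`-integrable (as an extended-real-valued function). -/
def FieldIntegrable (f : X → EReal) (μ : Measure X) : Prop :=
  Integrable (fun x => (f x).toReal) μ ∧ (∀ᵐ x ∂μ, f x ≠ ⊤ ∧ f x ≠ ⊥)

/-- `∫ f dμ` for an a.e.-finite integrable field. -/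
def fieldIntegral (f : X → EReal) (μ : Measure X) : ℝ := ∫ x, (f x).toReal ∂μ

/-- The Gauss functional `I_f(μ) := I(μ) + 2 ∫ f dμ`. -/
def gaussI (κ : X → X → ℝ≥0∞) (f : X → EReal) (μ : Measure X) : ℝ :=
  (energy κ μ).toReal + 2 * fieldIntegral f μ

/-- Membership in `Ĕ⁺_f(A)`. -/
def Admissible (κ : X → X → ℝ≥0∞) (A : Set X) (f : X → EReal) (μ : Measure X) : Prop :=
  memBreve κ A μ ∧ FieldIntegrable f μ

/-- `w_f(A) := inf { I_f(μ) : μ ∈ Ĕ⁺_f(A) }` (with `inf ∅ = ⊤`). -/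
def wf (κ : X → X → ℝ≥0∞) (A : Set X) (f : X → EReal) : EReal :=
  ⨅ (μ : Measure X) (_ : Admissible κ A f μ), ((gaussI κ f μ : ℝ) : EReal)

/-- `l` is a solution of the inner Gauss variational problem for `(A,f)`. -/
def IsSolution (κ : X → X → ℝ≥0∞) (A : Set X) (f : X → EReal) (l : Measure X) : Prop :=
  Admissible κ A f l ∧ ((gaussI κ f l : ℝ) : EReal) = wf κ A f

/-- The `f`-weighted potential `U_f^μ := U^μ + f`. -/
def wPotential (κ : X → X → ℝ≥0∞) (f : X → EReal) (μ : Measure X) (x : X) : EReal :=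
  (potential κ μ x : EReal) + f x

/-- `∫ U_f^μ dμ`, the weighted equilibrium constant of a solution. -/
def wConst (κ : X → X → ℝ≥0∞) (f : X → EReal) (μ : Measure X) : ℝ :=
  ∫ x, (wPotential κ f μ x).toReal ∂μ

/-- The cone `E⁺(A)` is closed in the strong metric. -/
def StrongClosedEplusOn (κ : X → X → ℝ≥0∞) (A : Set X) : Prop :=
  ∀ (μ : ℕ → Measure X) (μ₀ : Measure X),
    (∀ n, memEplus κ (μ n) ∧ Concentrated (μ n) A) →
    memEplus κ μ₀ → StrongTendstoSeq κ μ μ₀ → Concentrated μ₀ A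

/-- Frostman's (first) maximum principle. -/
def FrostmanMax (κ : X → X → ℝ≥0∞) : Prop :=
  ∀ μ : Measure X, memEplus κ μ →
    (∀ x : X, (∀ U : Set X, IsOpen U → x ∈ U → 0 < μ U) → potential κ μ x ≤ 1) →
    ∀ x : X, potential κ μ x ≤ 1

/-- The domination (second maximum) principle. -/
def DominationPrinciple (κ : X → X → ℝ≥0∞) : Prop :=
  ∀ μ ν : Measure X, memEplus κ μ → memEplus κ ν →
    (∀ᵐ x ∂μ, potential κ μ x ≤ potential κ ν x) →
    ∀ x : X, potential κ μ x ≤ potential κ ν x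

/-- `β` is the inner balayage of `ζ` onto `A`: `β ∈ E⁺(A)` and `U^β = U^ζ` n.e. on `A`. -/
def IsInnerBalayage (κ : X → X → ℝ≥0∞) (A : Set X) (ζ β : Measure X) : Prop :=
  memEplus κ β ∧ Concentrated β A ∧
    NearlyEverywhere κ A (fun x => potential κ β x = potential κ ζ x)

/-- `γ` is the inner capacitary measure of `A`: `γ ∈ E⁺(A)` and `U^γ = 1` n.e. on `A`. -/
def IsCapacitaryMeasure (κ : X → X → ℝ≥0∞) (A : Set X) (γ : Measure X) : Prop :=
  memEplus κ γ ∧ Concentrated γ A ∧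
    NearlyEverywhere κ A (fun x => potential κ γ x = 1)

/-- `A` is quasiclosed: approximable in outer capacity by closed sets. -/
def Quasiclosed (κ : X → X → ℝ≥0∞) (A : Set X) : Prop :=
  ∀ ε : ℝ≥0∞, 0 < ε → ∃ F : Set X, IsClosed F ∧ outerCap κ (symmDiff A F) < ε

/-- `A` is quasicompact: approximable in outer capacity by compact sets. -/
def Quasicompact (κ : X → X → ℝ≥0∞) (A : Set X) : Prop :=
  ∀ ε : ℝ≥0∞, 0 < ε → ∃ K : Set X, IsCompact K ∧ outerCap κ (symmDiff A K) < ε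


/-- Euclidean space `ℝⁿ`. -/
abbrev Rn (n : ℕ) := EuclideanSpace ℝ (Fin n)

/-- The α-Riesz kernel `|x−y|^(α−n)` on `ℝⁿ` (with value `∞` on the diagonal). -/
def rieszKernel (n : ℕ) (α : ℝ) : Rn n → Rn n → ℝ≥0∞ :=
  fun x y => (ENNReal.ofReal (dist x y)) ^ (α - (n : ℝ))

/-- `B` is inner α-thin at infinity. -/
def InnerThinAtInfinity (n : ℕ) (α : ℝ) (B : Set (Rn n)) : Prop :=
  ∃ q : ℝ, 1 < q ∧
    (∑' k : ℕ, innerCap (rieszKernel n α)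
        (B ∩ {x : Rn n | q ^ k ≤ ‖x‖ ∧ ‖x‖ < q ^ (k + 1)}) /
      ENNReal.ofReal (q ^ ((k : ℝ) * ((n : ℝ) - α)))) ≠ ⊤

section Gaussian

variable {E : Type*} [NormedAddCommGroup E] [InnerProductSpace ℝ E] [FiniteDimensional ℝ E]
  [MeasurableSpace E] [BorelSpace E]

/-- The unnormalised Gaussian `exp (-b |x - z|²)`, with values in `[0,∞]`. -/
def gauss (b : ℝ) (x z : E) : ℝ≥0∞ := ENNReal.ofReal (Real.exp (-b * ‖x - z‖ ^ 2))

/-- The total mass of the Gaussian `exp (-2 b |z|²)`. -/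
def gaussMass (E : Type*) [NormedAddCommGroup E] [InnerProductSpace ℝ E] [FiniteDimensional ℝ E]
    [MeasurableSpace E] [BorelSpace E] (b : ℝ) : ℝ≥0∞ :=
  ∫⁻ z : E, ENNReal.ofReal (Real.exp (-(2 * b) * ‖z‖ ^ 2))

lemma gaussMass_eq {b : ℝ} (hb : 0 < b) :
    gaussMass E b = ENNReal.ofReal ((Real.pi / (2 * b)) ^ (Module.finrank ℝ E / 2 : ℝ)) := by
  have h := GaussianFourier.integral_rexp_neg_mul_sq_norm (V := E) (b := 2 * b) (by positivity)
  have hpos : 0 < (Real.pi / (2 * b)) ^ (Module.finrank ℝ E / 2 : ℝ) := by positivity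
  have hint : Integrable (fun v : E => Real.exp (-(2 * b) * ‖v‖ ^ 2)) := by
    by_contra hni
    rw [integral_undef hni] at h
    exact hpos.ne h
  rw [gaussMass, ← ofReal_integral_eq_lintegral_ofReal hint
    (ae_of_all _ fun _ => (Real.exp_pos _).le), h]

lemma gaussMass_ne_zero {b : ℝ} (hb : 0 < b) : gaussMass E b ≠ 0 := by
  rw [gaussMass_eq hb, Ne, ENNReal.ofReal_eq_zero, not_le]
  positivity

lemma gaussMass_ne_top {b : ℝ} (hb : 0 < b) : gaussMass E b ≠ ⊤ := by
  rw [gaussMass_eq hb]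
  exact ENNReal.ofReal_ne_top

lemma measurable_gaussMass : Measurable (gaussMass E) := by
  unfold gaussMass
  refine Measurable.lintegral_prod_right' (f := fun q : ℝ × E =>
    ENNReal.ofReal (Real.exp (-(2 * q.1) * ‖q.2‖ ^ 2))) ?_
  fun_prop

lemma lintegral_gauss_mul_gauss (b : ℝ) (x y : E) :
    ∫⁻ z, gauss b x z * gauss b y z = gaussMass E b * gauss (b / 2) x y := by
  have key : ∀ z : E, gauss b x z * gauss b y z =
      ENNReal.ofReal (Real.exp (-(2 * b) * ‖z - (2⁻¹ : ℝ) • (x + y)‖ ^ 2)) * gauss (b / 2) x y := by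
    intro z
    unfold gauss
    rw [← ENNReal.ofReal_mul (Real.exp_pos _).le, ← ENNReal.ofReal_mul (Real.exp_pos _).le,
      ← Real.exp_add, ← Real.exp_add]
    congr 2
    have h := parallelogram_law_with_norm ℝ (x - z) (y - z)
    have h1 : x - z + (y - z) = (-2 : ℝ) • (z - (2⁻¹ : ℝ) • (x + y)) := by module
    have h2 : x - z - (y - z) = x - y := by abel
    rw [h1, h2, norm_smul, Real.norm_eq_abs, abs_neg, abs_two] at h
    linear_combination (b / 2) * h
  simp_rw [key]
  rw [lintegral_mul_const _ (by fun_prop), gaussMass]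
  congr 1
  exact lintegral_sub_right_eq_self
    (fun z : E => ENNReal.ofReal (Real.exp (-(2 * b) * ‖z‖ ^ 2))) ((2⁻¹ : ℝ) • (x + y))

end Gaussian

lemma lintegral_rpow_mul_exp_sq {p : ℝ} (hp : 0 < p) {s : ℝ} (hs : 0 ≤ s) :
    ∫⁻ b in Ioi (0 : ℝ), ENNReal.ofReal (b ^ (p / 2 - 1)) *
        ENNReal.ofReal (Real.exp (-(b / 2) * s ^ 2)) =
      ENNReal.ofReal (2 ^ (p / 2) * Real.Gamma (p / 2)) * ENNReal.ofReal s ^ (-p) := by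
  have hΓ : 0 < Real.Gamma (p / 2) := Real.Gamma_pos_of_pos (by positivity)
  rcases hs.eq_or_lt with rfl | hs
  · have hc : ENNReal.ofReal (2 ^ (p / 2) * Real.Gamma (p / 2)) ≠ 0 := by
      rw [Ne, ENNReal.ofReal_eq_zero, not_le]
      positivity
    rw [ENNReal.ofReal_zero, ENNReal.zero_rpow_of_neg (by linarith), ENNReal.mul_top hc]
    have hni := not_integrableOn_Ioi_rpow (p / 2 - 1)
    by_contra hfin
    apply hni
    refine ⟨by fun_prop, ?_⟩
    rw [hasFiniteIntegral_iff_norm]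
    refine lt_of_le_of_lt (le_of_eq ?_) (lt_top_iff_ne_top.2 hfin)
    refine setLIntegral_congr_fun measurableSet_Ioi fun b hb => ?_
    have hb : (0 : ℝ) < b := hb
    simp [abs_of_pos (Real.rpow_pos_of_pos hb _)]
  · have h := Real.integral_rpow_mul_exp_neg_mul_Ioi (a := p / 2) (r := s ^ 2 / 2)
      (by positivity) (by positivity)
    have hpos : 0 < (1 / (s ^ 2 / 2)) ^ (p / 2) * Real.Gamma (p / 2) := by positivity
    have hint : IntegrableOn (fun t : ℝ => t ^ (p / 2 - 1) * Real.exp (-(s ^ 2 / 2 * t)))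
        (Ioi 0) := by
      by_contra hni
      rw [integral_undef hni] at h
      exact hpos.ne h
    have hval : (1 / (s ^ 2 / 2)) ^ (p / 2) * Real.Gamma (p / 2) =
        2 ^ (p / 2) * Real.Gamma (p / 2) * s ^ (-p) := by
      have : (1 / (s ^ 2 / 2) : ℝ) = 2 * s ^ (-2 : ℝ) := by
        rw [Real.rpow_neg hs.le]
        norm_num
        field_simp
      rw [this, Real.mul_rpow (by norm_num) (by positivity), ← Real.rpow_mul hs.le]
      rw [show (-2 : ℝ) * (p / 2) = -p by ring]
      ring
    rw [ENNReal.ofReal_rpow_of_pos hs, ← ENNReal.ofReal_mul (by positivity), ← hval, ← h,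
      ofReal_integral_eq_lintegral_ofReal hint]
    · refine setLIntegral_congr_fun measurableSet_Ioi fun b hb => ?_
      have hb : (0 : ℝ) < b := hb
      rw [← ENNReal.ofReal_mul (by positivity)]
      ring_nf
    · filter_upwards [ae_restrict_mem measurableSet_Ioi] with b hb
      have hb : (0 : ℝ) < b := hb
      positivity

section Representation

variable {n : ℕ} {α : ℝ}

/-- The measure on `(0,∞) × ℝⁿ` against which the Riesz kernel is an integral of products of
Gaussians. -/
def gaussMixture (n : ℕ) (p : ℝ) : Measure (ℝ × Rn n) :=
  (((volume : Measure ℝ).restrict (Ioi 0)).withDensity fun b =>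
    (ENNReal.ofReal (2 ^ (p / 2) * Real.Gamma (p / 2)))⁻¹ *
      (ENNReal.ofReal (b ^ (p / 2 - 1)) * (gaussMass (Rn n) b)⁻¹)).prod volume

instance (p : ℝ) : SFinite (gaussMixture n p) := by
  unfold gaussMixture
  infer_instance

lemma measurable_rieszKernel : Measurable fun q : Rn n × Rn n => rieszKernel n α q.1 q.2 := by
  unfold rieszKernel
  fun_prop

lemma rieszKernel_eq_lintegral (hαn : α < n) (x y : Rn n) :
    rieszKernel n α x y =
      ∫⁻ ω, gauss ω.1 x ω.2 * gauss ω.1 y ω.2 ∂gaussMixture n (n - α) := by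
  set p : ℝ := n - α with hp_def
  have hp : 0 < p := by simp only [hp_def]; linarith
  have hΓ : 0 < Real.Gamma (p / 2) := Real.Gamma_pos_of_pos (by positivity)
  have hc0 : ENNReal.ofReal (2 ^ (p / 2) * Real.Gamma (p / 2)) ≠ 0 := by
    rw [Ne, ENNReal.ofReal_eq_zero, not_le]
    positivity
  have hw : Measurable fun b : ℝ => (ENNReal.ofReal (2 ^ (p / 2) * Real.Gamma (p / 2)))⁻¹ *
      (ENNReal.ofReal (b ^ (p / 2 - 1)) * (gaussMass (Rn n) b)⁻¹) := by
    have := measurable_gaussMass (E := Rn n)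
    fun_prop
  have hF : Measurable fun ω : ℝ × Rn n => gauss ω.1 x ω.2 * gauss ω.1 y ω.2 := by
    unfold gauss
    fun_prop
  rw [gaussMixture, lintegral_prod _ hF.aemeasurable,
    lintegral_withDensity_eq_lintegral_mul _ hw hF.lintegral_prod_right']
  have hcongr : ∀ b ∈ Ioi (0 : ℝ),
      ((fun b : ℝ => (ENNReal.ofReal (2 ^ (p / 2) * Real.Gamma (p / 2)))⁻¹ *
        (ENNReal.ofReal (b ^ (p / 2 - 1)) * (gaussMass (Rn n) b)⁻¹)) *
          fun b => ∫⁻ z, gauss b x z * gauss b y z) b =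
      (ENNReal.ofReal (2 ^ (p / 2) * Real.Gamma (p / 2)))⁻¹ *
        (ENNReal.ofReal (b ^ (p / 2 - 1)) *
          ENNReal.ofReal (Real.exp (-(b / 2) * dist x y ^ 2))) := by
    intro b hb
    have hb : (0 : ℝ) < b := hb
    simp only [Pi.mul_apply]
    rw [lintegral_gauss_mul_gauss, mul_assoc, mul_assoc, ← mul_assoc (gaussMass (Rn n) b)⁻¹,
      ENNReal.inv_mul_cancel (gaussMass_ne_zero hb) (gaussMass_ne_top hb), one_mul,
      gauss, dist_eq_norm]
  rw [setLIntegral_congr_fun measurableSet_Ioi hcongr, lintegral_const_mul _ (by fun_prop),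
    lintegral_rpow_mul_exp_sq hp dist_nonneg, ← mul_assoc,
    ENNReal.inv_mul_cancel hc0 ENNReal.ofReal_ne_top, one_mul, rieszKernel, hp_def, neg_sub]

lemma mutualEnergy_eq_lintegral_gauss (hαn : α < n) (μ ν : Measure (Rn n)) [SFinite μ]
    [SFinite ν] :
    mutualEnergy (rieszKernel n α) μ ν =
      ∫⁻ ω, (∫⁻ x, gauss ω.1 x ω.2 ∂μ) * (∫⁻ y, gauss ω.1 y ω.2 ∂ν) ∂gaussMixture n (n - α) := by
  unfold mutualEnergy
  simp_rw [rieszKernel_eq_lintegral hαn]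
  rw [lintegral_lintegral_swap]
  · refine lintegral_congr fun ω => ?_
    have hg : Measurable fun x : Rn n => gauss ω.1 x ω.2 := by
      unfold gauss
      fun_prop
    exact lintegral_prod_mul hg.aemeasurable hg.aemeasurable
  · unfold gauss
    fun_prop

end Representation

lemma exists_gauss_le_mul_gauss {E : Type*} [NormedAddCommGroup E] {b b' : ℝ} (hb : 0 < b)
    (h : b < b') (w z : E) :
    ∃ C : ℝ, ∀ x, gauss b' x w ≤ ENNReal.ofReal C * gauss b x z := by
  refine ⟨Real.exp (b * ‖w - z‖ ^ 2 + b ^ 2 * ‖w - z‖ ^ 2 / (b' - b)), fun x => ?_⟩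
  unfold gauss
  rw [← ENNReal.ofReal_mul (Real.exp_pos _).le, ← Real.exp_add]
  refine ENNReal.ofReal_le_ofReal (Real.exp_le_exp.2 ?_)
  have hbb : 0 < b' - b := sub_pos.2 h
  have htri : ‖x - z‖ ≤ ‖x - w‖ + ‖w - z‖ := by
    simpa using norm_add_le (x - w) (w - z)
  have hsq : ‖x - z‖ ^ 2 ≤ (‖x - w‖ + ‖w - z‖) ^ 2 := by gcongr
  have hmul := mul_le_mul_of_nonneg_left hsq hb.le
  have hid : (b' - b) * (‖x - w‖ - b * ‖w - z‖ / (b' - b)) ^ 2 =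
      (b' - b) * ‖x - w‖ ^ 2 - 2 * b * ‖x - w‖ * ‖w - z‖ + b ^ 2 * ‖w - z‖ ^ 2 / (b' - b) := by
    field_simp
    ring
  have hnn : 0 ≤ (b' - b) * (‖x - w‖ - b * ‖w - z‖ / (b' - b)) ^ 2 := by positivity
  nlinarith

section Uniqueness

variable {E : Type*} [NormedAddCommGroup E] [InnerProductSpace ℝ E] [FiniteDimensional ℝ E]
  [MeasurableSpace E] [BorelSpace E]

lemma lintegral_exp_inner_withDensity_gauss {b : ℝ} (hb : 0 < b) (μ : Measure E) (v : E) (t : ℝ) :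
    ∫⁻ x, ENNReal.ofReal (Real.exp (t * inner ℝ x v)) ∂μ.withDensity (fun x => gauss b x 0) =
      ENNReal.ofReal (Real.exp (b * ‖(t / (2 * b)) • v‖ ^ 2)) *
        ∫⁻ x, gauss b x ((t / (2 * b)) • v) ∂μ := by
  have hm : ∀ z : E, Measurable fun x => gauss b x z := fun z => by
    unfold gauss
    fun_prop
  rw [lintegral_withDensity_eq_lintegral_mul _ (hm 0) (by fun_prop), ← lintegral_const_mul _ (hm _)]
  refine lintegral_congr fun x => ?_
  simp only [Pi.mul_apply, gauss]
  rw [← ENNReal.ofReal_mul (Real.exp_pos _).le, ← ENNReal.ofReal_mul (Real.exp_pos _).le,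
    ← Real.exp_add, ← Real.exp_add]
  congr 2
  rw [norm_sub_sq_real x ((t / (2 * b)) • v), inner_smul_right, sub_zero]
  field_simp
  ring

lemma integrable_and_integral_exp_inner {b : ℝ} (hb : 0 < b) {μ : Measure E}
    (hfin : ∀ w, ∫⁻ x, gauss b x w ∂μ ≠ ⊤) (v : E) (t : ℝ) :
    Integrable (fun x => Real.exp (t * inner ℝ x v)) (μ.withDensity fun x => gauss b x 0) ∧
    ∫ x, Real.exp (t * inner ℝ x v) ∂μ.withDensity (fun x => gauss b x 0) =
      (ENNReal.ofReal (Real.exp (b * ‖(t / (2 * b)) • v‖ ^ 2)) *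
        ∫⁻ x, gauss b x ((t / (2 * b)) • v) ∂μ).toReal := by
  have h := lintegral_exp_inner_withDensity_gauss hb μ v t
  refine ⟨⟨by fun_prop, ?_⟩, ?_⟩
  · rw [hasFiniteIntegral_iff_ofReal (ae_of_all _ fun _ => (Real.exp_pos _).le), h]
    exact ENNReal.mul_lt_top ENNReal.ofReal_lt_top (lt_top_iff_ne_top.2 (hfin _))
  · rw [integral_eq_lintegral_of_nonneg_ae (ae_of_all _ fun _ => (Real.exp_pos _).le)
      (by fun_prop), h]

/-- A measure is determined by its convolution with a Gaussian. -/
lemma eq_of_lintegral_gauss_eq {b : ℝ} (hb : 0 < b) {μ ν : Measure E}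
    (hfin : ∀ w, ∫⁻ x, gauss b x w ∂μ ≠ ⊤)
    (h : ∀ w, ∫⁻ x, gauss b x w ∂μ = ∫⁻ x, gauss b x w ∂ν) : μ = ν := by
  have hfin' : ∀ w, ∫⁻ x, gauss b x w ∂ν ≠ ⊤ := fun w => h w ▸ hfin w
  have hm : Measurable fun x : E => gauss b x 0 := by
    unfold gauss
    fun_prop
  have hne : ∀ ρ : Measure E, ∀ᵐ x ∂ρ, gauss b x (0 : E) ≠ 0 := fun ρ => ae_of_all _ fun x => by
    rw [gauss, Ne, ENNReal.ofReal_eq_zero, not_le]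
    positivity
  have htop : ∀ ρ : Measure E, ∀ᵐ x ∂ρ, gauss b x (0 : E) ≠ ⊤ := fun ρ =>
    ae_of_all _ fun x => ENNReal.ofReal_ne_top
  set μ' := μ.withDensity fun x => gauss b x 0 with hμ'
  set ν' := ν.withDensity fun x => gauss b x 0 with hν'
  have : IsFiniteMeasure μ' := isFiniteMeasure_withDensity (hfin 0)
  have : IsFiniteMeasure ν' := isFiniteMeasure_withDensity (hfin' 0)
  suffices hE : μ' = ν' by
    rw [← withDensity_inv_same hm (hne μ) (htop μ), ← withDensity_inv_same hm (hne ν) (htop ν),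
      ← hμ', ← hν', hE]
  have huniv : μ' univ = ν' univ := by
    rw [hμ', hν', withDensity_apply _ MeasurableSet.univ, withDensity_apply _ MeasurableSet.univ,
      setLIntegral_univ, setLIntegral_univ, h]
  refine Measure.ext_of_charFun (funext fun v => ?_)
  have hmgf : ProbabilityTheory.mgf (fun x => inner ℝ x v) μ' =
      ProbabilityTheory.mgf (fun x => inner ℝ x v) ν' := by
    ext t
    unfold ProbabilityTheory.mgf
    rw [(integrable_and_integral_exp_inner hb hfin v t).2,
      (integrable_and_integral_exp_inner hb hfin' v t).2, h]
  have hset : ProbabilityTheory.integrableExpSet (fun x => inner ℝ x v) μ' = univ :=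
    eq_univ_of_forall fun t => (integrable_and_integral_exp_inner hb hfin v t).1
  have := ProbabilityTheory.eqOn_complexMGF_of_mgf' hmgf
    (by rw [← Measure.measure_univ_eq_zero, huniv, Measure.measure_univ_eq_zero])
    (x := Complex.I) (by simp [hset])
  simpa [ProbabilityTheory.complexMGF, charFun_apply, mul_comm] using this

end Uniqueness

section EnergyPrinciple

variable {n : ℕ} {α : ℝ}

lemma ae_ae_of_ae_gaussMixture {p : ℝ} {P : ℝ × Rn n → Prop}
    (h : ∀ᵐ ω ∂gaussMixture n p, P ω) :
    ∀ᵐ b ∂(volume : Measure ℝ).restrict (Ioi 0), ∀ᵐ z, P (b, z) := by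
  have h1 := Measure.ae_ae_of_ae_prod h
  rw [ae_withDensity_iff (by have := measurable_gaussMass (E := Rn n); fun_prop)] at h1
  filter_upwards [h1, ae_restrict_mem measurableSet_Ioi] with b hb hb0
  have hb0 : (0 : ℝ) < b := hb0
  refine hb (mul_ne_zero (ENNReal.inv_ne_zero.2 ENNReal.ofReal_ne_top)
    (mul_ne_zero ?_ (ENNReal.inv_ne_zero.2 (gaussMass_ne_top hb0))))
  rw [Ne, ENNReal.ofReal_eq_zero, not_le]
  positivity

lemma two_mul_mul_le_sq_add_sq (a b : ℝ≥0∞) : 2 * (a * b) ≤ a * a + b * b := by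
  by_cases ha : a = ⊤
  · simp [ha]
  by_cases hb : b = ⊤
  · simp [hb]
  lift a to NNReal using ha
  lift b to NNReal using hb
  norm_cast
  rw [← NNReal.coe_le_coe]
  push_cast
  nlinarith [sq_nonneg ((a : ℝ) - b)]

lemma eq_of_two_mul_mul_eq {a b : ℝ≥0∞} (h : 2 * (a * b) = a * a + b * b) (ha : a ≠ ⊤)
    (hb : b ≠ ⊤) : a = b := by
  lift a to NNReal using ha
  lift b to NNReal using hb
  norm_cast at h ⊢
  rw [← NNReal.coe_inj] at h ⊢
  push_cast at h
  nlinarith [sq_nonneg ((a : ℝ) - b)]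

lemma sFinite_of_isRadon {μ : Measure (Rn n)} (h : IsRadon μ) : SFinite μ := by
  have : μ.Regular := h
  infer_instance

lemma energyPrinciple_rieszKernel (hαn : α < n) : EnergyPrinciple (rieszKernel n α) := by
  intro μ ν ⟨hμr, hμ⟩ ⟨hνr, hν⟩
  have := sFinite_of_isRadon hμr
  have := sFinite_of_isRadon hνr
  have hM : ∀ (ρ : Measure (Rn n)) [SFinite ρ],
      Measurable fun ω : ℝ × Rn n => ∫⁻ x, gauss ω.1 x ω.2 ∂ρ := fun ρ _ => by
    refine Measurable.lintegral_prod_right' (f := fun q : (ℝ × Rn n) × Rn n =>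
      gauss q.1.1 q.2 q.1.2) ?_
    unfold gauss
    fun_prop
  have hMμ := hM μ
  have hMν := hM ν
  unfold energy at hμ hν ⊢
  rw [mutualEnergy_eq_lintegral_gauss hαn] at hμ hν ⊢
  rw [mutualEnergy_eq_lintegral_gauss hαn, mutualEnergy_eq_lintegral_gauss hαn,
    ← lintegral_const_mul _ (by fun_prop), ← lintegral_add_left (by fun_prop)]
  refine ⟨lintegral_mono fun ω => two_mul_mul_le_sq_add_sq _ _, fun heq => ?_⟩
  have hfin : ∀ᵐ ω ∂gaussMixture n (n - α),
      (∫⁻ x, gauss ω.1 x ω.2 ∂μ) * (∫⁻ x, gauss ω.1 x ω.2 ∂μ) +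
        (∫⁻ x, gauss ω.1 x ω.2 ∂ν) * (∫⁻ x, gauss ω.1 x ω.2 ∂ν) < ⊤ := by
    refine ae_lt_top (by fun_prop) ?_
    rw [lintegral_add_left (by fun_prop)]
    exact (ENNReal.add_lt_top.2 ⟨hμ, hν⟩).ne
  have hae := ae_eq_of_ae_le_of_lintegral_le
    (ae_of_all (gaussMixture n (n - α)) fun ω =>
      two_mul_mul_le_sq_add_sq (∫⁻ x, gauss ω.1 x ω.2 ∂μ) (∫⁻ x, gauss ω.1 x ω.2 ∂ν))
    (by rw [heq, lintegral_add_left (by fun_prop)]; exact (ENNReal.add_lt_top.2 ⟨hμ, hν⟩).ne)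
    (by fun_prop) heq.ge
  have hgood : ∀ᵐ ω ∂gaussMixture n (n - α),
      (∫⁻ x, gauss ω.1 x ω.2 ∂μ) = (∫⁻ x, gauss ω.1 x ω.2 ∂ν) ∧
        (∫⁻ x, gauss ω.1 x ω.2 ∂μ) ≠ ⊤ := by
    filter_upwards [hfin, hae] with ω h1 h2
    have ha : (∫⁻ x, gauss ω.1 x ω.2 ∂μ) ≠ ⊤ := fun h => by simp [h] at h1
    have hb : (∫⁻ x, gauss ω.1 x ω.2 ∂ν) ≠ ⊤ := fun h => by simp [h] at h1
    exact ⟨eq_of_two_mul_mul_eq h2 ha hb, ha⟩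
  have hgood' := ae_ae_of_ae_gaussMixture hgood
  have : NeBot (ae ((volume : Measure ℝ).restrict (Ioi 0))) := by
    rw [ae_restrict_neBot]
    simp
  obtain ⟨b, hb, hb0⟩ := (hgood'.and (ae_restrict_mem measurableSet_Ioi)).exists
  have hb0 : (0 : ℝ) < b := hb0
  have : NeBot (ae ((volume : Measure ℝ).restrict (Ioo 0 (b / 2)))) := by
    rw [ae_restrict_neBot]
    simp [hb0]
  obtain ⟨b₁, hb₁, hb₁0⟩ := ((ae_restrict_of_ae_restrict_of_subset
    (Ioo_subset_Ioi_self : Ioo 0 (b / 2) ⊆ Ioi 0) hgood').and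
      (ae_restrict_mem measurableSet_Ioo)).exists
  obtain ⟨z₁, -, hz₁⟩ := hb₁.exists
  refine eq_of_lintegral_gauss_eq (half_pos hb0) (fun w => ?_) fun w => ?_
  · obtain ⟨C, hC⟩ := exists_gauss_le_mul_gauss hb₁0.1 hb₁0.2 w z₁
    refine ne_top_of_le_ne_top ?_ (lintegral_mono hC)
    rw [lintegral_const_mul _ (by unfold gauss; fun_prop)]
    exact ENNReal.mul_ne_top ENNReal.ofReal_ne_top hz₁
  · have hconv : ∀ (ρ : Measure (Rn n)) [SFinite ρ],
        ∫⁻ z, (∫⁻ x, gauss b x z ∂ρ) * gauss b w z =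
          gaussMass (Rn n) b * ∫⁻ x, gauss (b / 2) x w ∂ρ := by
      intro ρ _
      rw [← lintegral_const_mul _ (by unfold gauss; fun_prop)]
      simp_rw [← lintegral_gauss_mul_gauss]
      rw [lintegral_lintegral_swap (by unfold gauss; fun_prop)]
      refine lintegral_congr fun z => ?_
      rw [lintegral_mul_const _ (by unfold gauss; fun_prop)]
    have h1 : ∫⁻ z, (∫⁻ x, gauss b x z ∂μ) * gauss b w z =
        ∫⁻ z, (∫⁻ x, gauss b x z ∂ν) * gauss b w z := by
      refine lintegral_congr_ae ?_
      filter_upwards [hb] with z hz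
      rw [hz.1]
    rw [hconv, hconv] at h1
    exact (ENNReal.mul_right_inj (gaussMass_ne_zero hb0) (gaussMass_ne_top hb0)).1 h1

end EnergyPrinciple

section Potential

variable {n : ℕ} {α : ℝ}

lemma rieszKernel_comm (x y : Rn n) : rieszKernel n α x y = rieszKernel n α y x := by
  rw [rieszKernel, rieszKernel, dist_comm]

lemma rieszKernel_le_of_dist_le (hαn : α < n) {t : ℝ} (ht : 0 < t) {a b c d : Rn n}
    (h : dist a b ≤ t * dist c d) :
    rieszKernel n α c d ≤ ENNReal.ofReal t ^ ((n : ℝ) - α) * rieszKernel n α a b := by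
  have hp : 0 < (n : ℝ) - α := by linarith
  have ht0 : ENNReal.ofReal t ^ ((n : ℝ) - α) ≠ 0 := by
    rw [Ne, ENNReal.rpow_eq_zero_iff_of_pos hp, ENNReal.ofReal_eq_zero, not_le]
    exact ht
  have htt : ENNReal.ofReal t ^ ((n : ℝ) - α) ≠ ⊤ :=
    ENNReal.rpow_ne_top_of_nonneg hp.le ENNReal.ofReal_ne_top
  have hle : ENNReal.ofReal (dist a b) ^ ((n : ℝ) - α) ≤
      ENNReal.ofReal t ^ ((n : ℝ) - α) * ENNReal.ofReal (dist c d) ^ ((n : ℝ) - α) := by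
    rw [← ENNReal.mul_rpow_of_nonneg _ _ hp.le, ← ENNReal.ofReal_mul ht.le]
    gcongr
  have hinv := ENNReal.inv_le_inv.2 hle
  rw [ENNReal.mul_inv (Or.inl ht0) (Or.inl htt)] at hinv
  unfold rieszKernel
  rw [show α - (n : ℝ) = -((n : ℝ) - α) by ring, ENNReal.rpow_neg, ENNReal.rpow_neg]
  calc (ENNReal.ofReal (dist c d) ^ ((n : ℝ) - α))⁻¹
      = ENNReal.ofReal t ^ ((n : ℝ) - α) * ((ENNReal.ofReal t ^ ((n : ℝ) - α))⁻¹ *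
          (ENNReal.ofReal (dist c d) ^ ((n : ℝ) - α))⁻¹) := by
        rw [← mul_assoc, ENNReal.mul_inv_cancel ht0 htt, one_mul]
    _ ≤ _ := by gcongr

lemma rieszKernel_le_of_le_dist (hαn : α < n) {r : ℝ} {x y : Rn n} (h : r ≤ dist x y) :
    rieszKernel n α x y ≤ ENNReal.ofReal r ^ (α - (n : ℝ)) := by
  rw [rieszKernel, show α - (n : ℝ) = -((n : ℝ) - α) by ring, ENNReal.rpow_neg, ENNReal.rpow_neg]
  have : 0 ≤ (n : ℝ) - α := by linarith
  gcongr

lemma le_rieszKernel_of_dist_le (hαn : α < n) {r : ℝ} {x y : Rn n} (h : dist x y ≤ r) :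
    ENNReal.ofReal r ^ (α - (n : ℝ)) ≤ rieszKernel n α x y := by
  rw [rieszKernel, show α - (n : ℝ) = -((n : ℝ) - α) by ring, ENNReal.rpow_neg, ENNReal.rpow_neg]
  have : 0 ≤ (n : ℝ) - α := by linarith
  gcongr

lemma measurable_rieszKernel_right (x : Rn n) : Measurable fun y => rieszKernel n α x y := by
  unfold rieszKernel
  fun_prop

lemma measurable_potential (μ : Measure (Rn n)) [SFinite μ] :
    Measurable (potential (rieszKernel n α) μ) :=
  measurable_rieszKernel.lintegral_prod_right'

lemma potential_smul (c : ℝ≥0∞) (μ : Measure (Rn n)) (x : Rn n) :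
    potential (rieszKernel n α) (c • μ) x = c * potential (rieszKernel n α) μ x := by
  simp [potential]

lemma mutualEnergy_eq_lintegral_potential (μ ν : Measure (Rn n)) [SFinite ν] :
    mutualEnergy (rieszKernel n α) μ ν = ∫⁻ x, potential (rieszKernel n α) ν x ∂μ :=
  lintegral_prod _ measurable_rieszKernel.aemeasurable

lemma mutualEnergy_comm (μ ν : Measure (Rn n)) [SFinite μ] [SFinite ν] :
    mutualEnergy (rieszKernel n α) μ ν = mutualEnergy (rieszKernel n α) ν μ := by
  unfold mutualEnergy
  rw [← lintegral_prod_swap]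
  simp [rieszKernel_comm]

lemma mutualEnergy_add_left (μ ν ρ : Measure (Rn n)) [SFinite ρ] :
    mutualEnergy (rieszKernel n α) (μ + ν) ρ =
      mutualEnergy (rieszKernel n α) μ ρ + mutualEnergy (rieszKernel n α) ν ρ := by
  simp_rw [mutualEnergy_eq_lintegral_potential, lintegral_add_measure]

lemma mutualEnergy_smul_left (c : ℝ≥0∞) (μ ρ : Measure (Rn n)) [SFinite ρ] :
    mutualEnergy (rieszKernel n α) (c • μ) ρ = c * mutualEnergy (rieszKernel n α) μ ρ := by
  simp_rw [mutualEnergy_eq_lintegral_potential, lintegral_smul_measure, smul_eq_mul]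

lemma energy_smul (c : ℝ≥0∞) (μ : Measure (Rn n)) [SFinite μ] :
    energy (rieszKernel n α) (c • μ) = c ^ 2 * energy (rieszKernel n α) μ := by
  rw [energy, mutualEnergy_smul_left, mutualEnergy_comm, mutualEnergy_smul_left, energy, sq,
    mul_assoc]

lemma energy_add (μ ν : Measure (Rn n)) [SFinite μ] [SFinite ν] :
    energy (rieszKernel n α) (μ + ν) = energy (rieszKernel n α) μ +
      2 * mutualEnergy (rieszKernel n α) ν μ + energy (rieszKernel n α) ν := by
  rw [energy, mutualEnergy_add_left, mutualEnergy_comm, mutualEnergy_add_left,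
    mutualEnergy_comm ν (μ + ν), mutualEnergy_add_left, mutualEnergy_comm μ ν, energy, energy]
  ring

lemma Concentrated.measure_compl_eq_zero {μ : Measure (Rn n)} {A : Set (Rn n)}
    (h : Concentrated μ A) : μ Aᶜ = 0 := by
  rw [← inter_univ Aᶜ, ← iUnion_compactCovering (Rn n), inter_iUnion]
  exact measure_iUnion_null fun k => h _ (isCompact_compactCovering _ k)

lemma concentrated_of_measure_compl_eq_zero {μ : Measure (Rn n)} {A : Set (Rn n)}
    (h : μ Aᶜ = 0) : Concentrated μ A :=
  fun _ _ => measure_mono_null inter_subset_left h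

lemma isRadon_of_isFiniteMeasure (μ : Measure (Rn n)) [IsFiniteMeasure μ] : IsRadon μ :=
  show μ.Regular from inferInstance

/-- A weak form of the maximum principle, valid for all `α < n`. -/
lemma potential_le_of_le_on_isCompact (hαn : α < n) {μ : Measure (Rn n)} {K : Set (Rn n)}
    (hK : IsCompact K) (hμK : μ Kᶜ = 0) {M : ℝ≥0∞}
    (hM : ∀ x ∈ K, potential (rieszKernel n α) μ x ≤ M) (x : Rn n) :
    potential (rieszKernel n α) μ x ≤ ENNReal.ofReal 2 ^ ((n : ℝ) - α) * M := by
  have hae : ∀ᵐ y ∂μ, y ∈ K := by rwa [ae_iff]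
  rcases K.eq_empty_or_nonempty with rfl | hne
  · have : μ = 0 := by simpa using hμK
    simp [this, potential]
  · obtain ⟨x', hx', hdist⟩ := hK.exists_infDist_eq_dist hne x
    have hle : ∀ᵐ y ∂μ, rieszKernel n α x y ≤
        ENNReal.ofReal 2 ^ ((n : ℝ) - α) * rieszKernel n α x' y := by
      filter_upwards [hae] with y hy
      refine rieszKernel_le_of_dist_le hαn two_pos ?_
      have h1 : dist x x' ≤ dist x y := hdist ▸ Metric.infDist_le_dist_of_mem hy
      have h2 := dist_triangle_left x' y x
      linarith
    calc potential (rieszKernel n α) μ x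
        ≤ ∫⁻ y, ENNReal.ofReal 2 ^ ((n : ℝ) - α) * rieszKernel n α x' y ∂μ :=
          lintegral_mono_ae hle
      _ = ENNReal.ofReal 2 ^ ((n : ℝ) - α) * potential (rieszKernel n α) μ x' :=
          lintegral_const_mul _ (measurable_rieszKernel_right x')
      _ ≤ _ := by gcongr; exact hM x' hx'

lemma wcap_ne_zero_of_bounded (hαn : α < n) {B : Set (Rn n)} {R : ℝ}
    (hB : ∀ x ∈ B, ‖x‖ ≤ R) : wcap (rieszKernel n α) B ≠ 0 := by
  have hpos : 0 < ENNReal.ofReal (2 * R) ^ (α - (n : ℝ)) := by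
    rw [pos_iff_ne_zero, Ne, ENNReal.rpow_eq_zero_iff]
    rintro (⟨-, h⟩ | ⟨h, -⟩)
    · linarith
    · exact ENNReal.ofReal_ne_top h
  refine (hpos.trans_le (le_iInf₂ fun μ hμ => ?_)).ne'
  have := sFinite_of_isRadon hμ.1.1
  have hae : ∀ᵐ y ∂μ, y ∈ B := by
    rw [ae_iff]
    exact hμ.2.1.measure_compl_eq_zero
  rw [energy, mutualEnergy_eq_lintegral_potential]
  have hU : ∀ᵐ x ∂μ, ENNReal.ofReal (2 * R) ^ (α - (n : ℝ)) ≤ potential (rieszKernel n α) μ x := by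
    filter_upwards [hae] with x hx
    calc ENNReal.ofReal (2 * R) ^ (α - (n : ℝ))
        = ∫⁻ _, ENNReal.ofReal (2 * R) ^ (α - (n : ℝ)) ∂μ := by simp [hμ.2.2]
      _ ≤ _ := by
        refine lintegral_mono_ae ?_
        filter_upwards [hae] with y hy
        refine le_rieszKernel_of_dist_le hαn ?_
        rw [dist_eq_norm]
        linarith [norm_sub_le x y, hB x hx, hB y hy]
  calc ENNReal.ofReal (2 * R) ^ (α - (n : ℝ))
      = ∫⁻ _, ENNReal.ofReal (2 * R) ^ (α - (n : ℝ)) ∂μ := by simp [hμ.2.2]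
    _ ≤ _ := lintegral_mono_ae hU

lemma potential_mono {μ ν : Measure (Rn n)} (h : μ ≤ ν) (x : Rn n) :
    potential (rieszKernel n α) μ x ≤ potential (rieszKernel n α) ν x :=
  lintegral_mono' h le_rfl

/-- A set of finite inner capacity carries a measure of comparable mass whose potential is at most
one everywhere. -/
lemma exists_potential_le_one (hαn : α < n) {B : Set (Rn n)}
    (hB : wcap (rieszKernel n α) B ≠ 0) :
    ∃ γ : Measure (Rn n), IsFiniteMeasure γ ∧ γ Bᶜ = 0 ∧
      (∀ x, potential (rieszKernel n α) γ x ≤ 1) ∧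
      innerCap (rieszKernel n α) B ≤ 16 * ENNReal.ofReal 2 ^ ((n : ℝ) - α) * γ univ := by
  by_cases htop : wcap (rieszKernel n α) B = ⊤
  · exact ⟨0, inferInstance, by simp, by simp [potential], by simp [innerCap, htop]⟩
  set P := ENNReal.ofReal 2 ^ ((n : ℝ) - α) with hP
  have hp : 0 < (n : ℝ) - α := by linarith
  have hP0 : P ≠ 0 := by simp [hP, ENNReal.rpow_eq_zero_iff_of_pos hp]
  have hPt : P ≠ ⊤ := ENNReal.rpow_ne_top_of_nonneg hp.le ENNReal.ofReal_ne_top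
  have hlt : wcap (rieszKernel n α) B < 2 * wcap (rieszKernel n α) B := by
    rw [two_mul]
    exact ENNReal.lt_add_right htop hB
  obtain ⟨μ, hμ⟩ := iInf_lt_iff.1 (show (⨅ (μ : Measure (Rn n))
    (_ : memBreve (rieszKernel n α) B μ), energy (rieszKernel n α) μ) < _ from hlt)
  obtain ⟨hμB, hμE⟩ := iInf_lt_iff.1 hμ
  set e := energy (rieszKernel n α) μ with he
  have he0 : e ≠ 0 := ((pos_iff_ne_zero.2 hB).trans_le (iInf₂_le μ hμB)).ne'
  have het : e ≠ ⊤ := hμB.1.2.ne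
  have := sFinite_of_isRadon hμB.1.1
  have : IsProbabilityMeasure μ := ⟨hμB.2.2⟩
  have hmeas := measurable_potential (α := α) μ
  have h2e0 : 2 * e ≠ 0 := mul_ne_zero two_ne_zero he0
  have h2et : 2 * e ≠ ⊤ := ENNReal.mul_ne_top ENNReal.ofNat_ne_top het
  have hmarkov : μ {x | 2 * e ≤ potential (rieszKernel n α) μ x} ≤ 2⁻¹ := by
    refine (meas_ge_le_lintegral_div hmeas.aemeasurable h2e0 h2et).trans (le_of_eq ?_)
    rw [← mutualEnergy_eq_lintegral_potential, ← energy, ← he, mul_comm,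
      ENNReal.div_eq_inv_mul, ENNReal.mul_inv (Or.inl he0) (Or.inl het), mul_right_comm,
      ENNReal.inv_mul_cancel he0 het, one_mul]
  have hset : MeasurableSet {x | potential (rieszKernel n α) μ x < 2 * e} :=
    measurableSet_lt hmeas measurable_const
  have hhalf : (4 : ℝ≥0∞)⁻¹ < μ {x | potential (rieszKernel n α) μ x < 2 * e} := by
    have hcompl : {x | potential (rieszKernel n α) μ x < 2 * e}ᶜ =
        {x | 2 * e ≤ potential (rieszKernel n α) μ x} := by
      ext x
      simp
    rw [← compl_compl {x | potential (rieszKernel n α) μ x < 2 * e},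
      prob_compl_eq_one_sub hset.compl, hcompl]
    calc (4 : ℝ≥0∞)⁻¹ < 2⁻¹ := ENNReal.inv_lt_inv.2 (by norm_num)
      _ = 1 - 2⁻¹ := by rw [ENNReal.one_sub_inv_two]
      _ ≤ _ := tsub_le_tsub_left hmarkov 1
  obtain ⟨K, hKs, hK, hμK⟩ := hset.exists_lt_isCompact_of_ne_top (measure_ne_top μ _) hhalf
  set c := (P * (2 * e))⁻¹ with hc
  have hPe0 : P * (2 * e) ≠ 0 := mul_ne_zero hP0 h2e0
  have hPet : P * (2 * e) ≠ ⊤ := ENNReal.mul_ne_top hPt h2et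
  have hct : c ≠ ⊤ := ENNReal.inv_ne_top.2 hPe0
  refine ⟨c • μ.restrict K, Measure.smul_finite _ hct, ?_, fun x => ?_, ?_⟩
  · rw [Measure.smul_apply, smul_eq_mul]
    refine mul_eq_zero_of_right _ ?_
    exact Measure.absolutelyContinuous_of_le Measure.restrict_le_self
      hμB.2.1.measure_compl_eq_zero
  · rw [potential_smul, hc, mul_comm, ← div_eq_mul_inv]
    refine ENNReal.div_le_of_le_mul ?_
    rw [one_mul]
    refine potential_le_of_le_on_isCompact hαn hK ?_ (fun y hy => ?_) x
    · rw [Measure.restrict_apply hK.measurableSet.compl]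
      simp
    · exact (potential_mono Measure.restrict_le_self y).trans (hKs hy).le
  · rw [Measure.smul_apply, Measure.restrict_apply_univ, smul_eq_mul, innerCap]
    have hwe : (wcap (rieszKernel n α) B)⁻¹ ≤ 2 * e⁻¹ := by
      rw [← ENNReal.inv_le_inv, inv_inv, ENNReal.mul_inv (Or.inl two_ne_zero)
        (Or.inl ENNReal.ofNat_ne_top), inv_inv]
      calc (2 : ℝ≥0∞)⁻¹ * e ≤ 2⁻¹ * (2 * wcap (rieszKernel n α) B) := by gcongr
        _ = wcap (rieszKernel n α) B := by
          rw [← mul_assoc, ENNReal.inv_mul_cancel two_ne_zero ENNReal.ofNat_ne_top, one_mul]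
    refine hwe.trans ?_
    calc 2 * e⁻¹ = 16 * (P * P⁻¹) * (2⁻¹ * e⁻¹ * 4⁻¹) := by
          rw [ENNReal.mul_inv_cancel hP0 hPt, mul_one]
          have : (16 : ℝ≥0∞) = 2 * 2 * 4 := by norm_num
          rw [this]
          calc 2 * e⁻¹ = 2 * (2 * 2⁻¹) * (4 * 4⁻¹) * e⁻¹ := by
                rw [ENNReal.mul_inv_cancel two_ne_zero ENNReal.ofNat_ne_top,
                  ENNReal.mul_inv_cancel four_ne_zero ENNReal.ofNat_ne_top, mul_one, mul_one]
            _ = _ := by ring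
      _ = 16 * P * (c * 4⁻¹) := by
          rw [hc, ENNReal.mul_inv (Or.inl hP0) (Or.inl hPt),
            ENNReal.mul_inv (Or.inl two_ne_zero) (Or.inl ENNReal.ofNat_ne_top)]
          ring
      _ ≤ _ := by gcongr

lemma NearlyEverywhere.ae {A : Set (Rn n)} {P : Rn n → Prop}
    (h : NearlyEverywhere (rieszKernel n α) A P) (hP : MeasurableSet {x | ¬ P x})
    {τ : Measure (Rn n)} [IsFiniteMeasure τ] (hτA : τ Aᶜ = 0)
    (hτ : energy (rieszKernel n α) τ ≠ ⊤) : ∀ᵐ x ∂τ, P x := by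
  by_contra hne
  rw [ae_iff] at hne
  obtain ⟨K, hKs, hK, hτK⟩ := hP.exists_lt_isCompact_of_ne_top (measure_ne_top τ _)
    (pos_iff_ne_zero.2 hne)
  have hinv : (τ K)⁻¹ ≠ ⊤ := ENNReal.inv_ne_top.2 hτK.ne'
  have hfin : IsFiniteMeasure ((τ K)⁻¹ • τ.restrict K) := Measure.smul_finite _ hinv
  have henergy : energy (rieszKernel n α) ((τ K)⁻¹ • τ.restrict K) < ⊤ := by
    rw [energy_smul]
    refine ENNReal.mul_lt_top (ENNReal.pow_lt_top (lt_top_iff_ne_top.2 hinv)) ?_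
    refine lt_of_le_of_lt ?_ (lt_top_iff_ne_top.2 hτ)
    rw [energy, energy, mutualEnergy_eq_lintegral_potential, mutualEnergy_eq_lintegral_potential]
    exact lintegral_mono' Measure.restrict_le_self (potential_mono Measure.restrict_le_self)
  have hmem : memBreve (rieszKernel n α) {x ∈ A | ¬ P x} ((τ K)⁻¹ • τ.restrict K) := by
    refine ⟨⟨isRadon_of_isFiniteMeasure _, henergy⟩, concentrated_of_measure_compl_eq_zero ?_, ?_⟩
    · rw [Measure.smul_apply, smul_eq_mul]
      refine mul_eq_zero_of_right _ ?_
      rw [Measure.restrict_apply' hK.measurableSet]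
      refine measure_mono_null (fun x hx => ?_) hτA
      exact fun hxA => hx.1 ⟨hxA, hKs hx.2⟩
    · rw [Measure.smul_apply, Measure.restrict_apply_univ, smul_eq_mul,
        ENNReal.inv_mul_cancel hτK.ne' (measure_ne_top τ K)]
  exact ((iInf₂_le _ hmem).trans_lt henergy).ne (ENNReal.inv_eq_zero.1 h)

lemma IsInnerBalayage.mutualEnergy_eq {A : Set (Rn n)} {ζ β : Measure (Rn n)}
    (hβ : IsInnerBalayage (rieszKernel n α) A ζ β) [SFinite ζ] {τ : Measure (Rn n)}
    [IsFiniteMeasure τ] (hτA : τ Aᶜ = 0) (hτ : energy (rieszKernel n α) τ ≠ ⊤) :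
    mutualEnergy (rieszKernel n α) τ β = mutualEnergy (rieszKernel n α) τ ζ := by
  have := sFinite_of_isRadon hβ.1.1
  rw [mutualEnergy_eq_lintegral_potential, mutualEnergy_eq_lintegral_potential]
  exact lintegral_congr_ae (hβ.2.2.ae
    (measurableSet_eq_fun (measurable_potential β) (measurable_potential ζ)).compl hτA hτ)

end Potential

section Escaping

variable {n : ℕ} {α : ℝ}

lemma potential_finsetSum {ι : Type*} (s : Finset ι) (γ : ι → Measure (Rn n)) (x : Rn n) :
    potential (rieszKernel n α) (∑ k ∈ s, γ k) x =
      ∑ k ∈ s, potential (rieszKernel n α) (γ k) x :=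
  lintegral_finsetSum_measure s _ γ

lemma potential_le_of_dist_le (hαn : α < n) {μ : Measure (Rn n)} {t : ℝ} (ht : 0 < t) {x x' : Rn n}
    (h : ∀ᵐ y ∂μ, dist x' y ≤ t * dist x y) :
    potential (rieszKernel n α) μ x ≤
      ENNReal.ofReal t ^ ((n : ℝ) - α) * potential (rieszKernel n α) μ x' := by
  unfold potential
  rw [← lintegral_const_mul _ (measurable_rieszKernel_right x')]
  refine lintegral_mono_ae ?_
  filter_upwards [h] with y hy
  exact rieszKernel_le_of_dist_le hαn ht hy

lemma card_filter_dyadic_le (s : Finset ℕ) (r : ℝ) [DecidablePred fun k : ℕ =>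
    r < 2 ^ (k + 2) ∧ (2 : ℝ) ^ k < 2 * r] :
    (s.filter fun k : ℕ => r < 2 ^ (k + 2) ∧ (2 : ℝ) ^ k < 2 * r).card ≤ 3 := by
  set u := s.filter fun k : ℕ => r < 2 ^ (k + 2) ∧ (2 : ℝ) ^ k < 2 * r with hu
  rcases u.eq_empty_or_nonempty with h | h
  · simp [h]
  · have hsub : u ⊆ Finset.Icc (u.min' h) (u.min' h + 2) := by
      intro k hk
      rw [Finset.mem_Icc]
      refine ⟨u.min'_le k hk, ?_⟩
      have h1 := (Finset.mem_filter.1 (u.min'_mem h)).2.1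
      have h2 := (Finset.mem_filter.1 hk).2.2
      have h3 : (2 : ℝ) ^ k < 2 ^ (u.min' h + 3) := by
        rw [show u.min' h + 3 = (u.min' h + 2) + 1 by ring, pow_succ]
        linarith
      have := (pow_lt_pow_iff_right₀ (one_lt_two (α := ℝ))).1 h3
      omega
    exact (Finset.card_le_card hsub).trans (by rw [Nat.card_Icc]; omega)

/-- The annulus `2 ^ k ≤ |x| < 2 ^ (k + 1)`. -/
def dyadicAnnulus (n k : ℕ) : Set (Rn n) := {x | 2 ^ k ≤ ‖x‖ ∧ ‖x‖ < 2 ^ (k + 1)}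

lemma potential_le_of_dyadicAnnulus (hαn : α < n) {γ : Measure (Rn n)} {k : ℕ}
    (hγ : ∀ᵐ y ∂γ, y ∈ dyadicAnnulus n k) {x : Rn n}
    (hx : ¬ (‖x‖ < 2 ^ (k + 2) ∧ (2 : ℝ) ^ k < 2 * ‖x‖)) :
    potential (rieszKernel n α) γ x ≤
      ENNReal.ofReal 2 ^ ((n : ℝ) - α) * potential (rieszKernel n α) γ 0 := by
  refine potential_le_of_dist_le hαn two_pos ?_
  filter_upwards [hγ] with y hy
  obtain ⟨hy1, hy2⟩ := hy
  rw [dist_zero_left, dist_eq_norm]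
  have h1 := norm_sub_norm_le x y
  have h2 := norm_sub_norm_le y x
  rw [norm_sub_rev y x] at h2
  by_cases h : ‖x‖ < 2 ^ (k + 2)
  · have h3 : 2 * ‖x‖ ≤ 2 ^ k := not_lt.1 fun h' => hx ⟨h, h'⟩
    linarith
  · have h3 : (2 : ℝ) ^ (k + 2) = 2 * 2 ^ (k + 1) := by ring
    linarith

lemma innerCap_div_le (hαn : α < n) {B : Set (Rn n)} {γ : Measure (Rn n)} {k : ℕ}
    (hγ : ∀ᵐ y ∂γ, y ∈ dyadicAnnulus n k) {D : ℝ≥0∞}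
    (hcap : innerCap (rieszKernel n α) B ≤ D * γ univ) :
    innerCap (rieszKernel n α) B / ENNReal.ofReal (2 ^ ((k : ℝ) * ((n : ℝ) - α))) ≤
      D * ENNReal.ofReal 2 ^ ((n : ℝ) - α) * potential (rieszKernel n α) γ 0 := by
  have h20 : ENNReal.ofReal 2 ≠ 0 := by simp
  have hw : (ENNReal.ofReal (2 ^ ((k : ℝ) * ((n : ℝ) - α))))⁻¹ =
      ENNReal.ofReal 2 ^ ((n : ℝ) - α) * ENNReal.ofReal (2 ^ (k + 1)) ^ (α - (n : ℝ)) := by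
    rw [← ENNReal.ofReal_rpow_of_pos two_pos, ENNReal.ofReal_pow zero_le_two,
      ← ENNReal.rpow_natCast, ← ENNReal.rpow_mul, ← ENNReal.rpow_neg,
      ← ENNReal.rpow_add _ _ h20 ENNReal.ofReal_ne_top]
    congr 1
    push_cast
    ring
  have hmass : ENNReal.ofReal (2 ^ (k + 1)) ^ (α - (n : ℝ)) * γ univ ≤
      potential (rieszKernel n α) γ 0 := by
    rw [← lintegral_const]
    refine lintegral_mono_ae ?_
    filter_upwards [hγ] with y hy
    refine le_rieszKernel_of_dist_le hαn ?_
    rw [dist_zero_left]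
    exact hy.2.le
  rw [div_eq_mul_inv, hw]
  calc innerCap (rieszKernel n α) B * (ENNReal.ofReal 2 ^ ((n : ℝ) - α) *
        ENNReal.ofReal (2 ^ (k + 1)) ^ (α - (n : ℝ)))
      ≤ (D * γ univ) * (ENNReal.ofReal 2 ^ ((n : ℝ) - α) *
        ENNReal.ofReal (2 ^ (k + 1)) ^ (α - (n : ℝ))) := by gcongr
    _ = D * ENNReal.ofReal 2 ^ ((n : ℝ) - α) *
        (ENNReal.ofReal (2 ^ (k + 1)) ^ (α - (n : ℝ)) * γ univ) := by ring
    _ ≤ _ := by gcongr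

lemma exists_one_le_sum_Ico {s : ℕ → ℝ≥0∞} (hs : ∀ k, s k ≤ 1) (htop : ∑' k, s k = ⊤) (M : ℕ) :
    ∃ N, 1 ≤ ∑ k ∈ Finset.Ico M N, s k := by
  have hlim := ENNReal.tendsto_nat_tsum s
  rw [htop] at hlim
  have hlt : ((M : ℝ≥0∞) + 1) < ⊤ := by
    exact_mod_cast ENNReal.natCast_lt_top (M + 1)
  obtain ⟨N, hN, hMN⟩ := ((hlim.eventually (lt_mem_nhds hlt)).and (eventually_ge_atTop M)).exists
  refine ⟨N, ?_⟩
  rw [Finset.range_eq_Ico, ← Finset.sum_Ico_consecutive s (Nat.zero_le M) hMN] at hN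
  have hM : ∑ k ∈ Finset.Ico 0 M, s k ≤ M :=
    (Finset.sum_le_card_nsmul _ _ 1 fun k _ => hs k).trans (by simp)
  have h := hN.le.trans (add_le_add_left hM _)
  exact (ENNReal.add_le_add_iff_left (ENNReal.natCast_ne_top M)).1 h

/-- A set which is not thin at infinity carries measures near infinity whose potentials are
uniformly bounded and equal to one at the origin. -/
lemma exists_measure_near_infinity (hαn : α < n) {A : Set (Rn n)}
    (hthin : ¬ InnerThinAtInfinity n α A) :
    ∃ C : ℝ≥0∞, C ≠ ⊤ ∧ ∀ M : ℕ, ∃ τ : Measure (Rn n), IsFiniteMeasure τ ∧ τ Aᶜ = 0 ∧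
      (∀ᵐ y ∂τ, 2 ^ M ≤ ‖y‖) ∧ potential (rieszKernel n α) τ 0 = 1 ∧
      ∀ x, potential (rieszKernel n α) τ x ≤ C := by
  classical
  set P := ENNReal.ofReal 2 ^ ((n : ℝ) - α) with hP
  have hp : 0 < (n : ℝ) - α := by linarith
  have hPt : P ≠ ⊤ := ENNReal.rpow_ne_top_of_nonneg hp.le ENNReal.ofReal_ne_top
  have hex : ∀ k : ℕ, ∃ γ : Measure (Rn n), IsFiniteMeasure γ ∧ γ (A ∩ dyadicAnnulus n k)ᶜ = 0 ∧
      (∀ x, potential (rieszKernel n α) γ x ≤ 1) ∧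
      innerCap (rieszKernel n α) (A ∩ dyadicAnnulus n k) ≤ 16 * P * γ univ := fun k =>
    exists_potential_le_one hαn (wcap_ne_zero_of_bounded hαn fun x hx => hx.2.2.le)
  choose γ hfin hnull hle hcap using hex
  have hann : ∀ k, ∀ᵐ y ∂γ k, y ∈ dyadicAnnulus n k := fun k => by
    rw [ae_iff]
    exact measure_mono_null (show (dyadicAnnulus n k)ᶜ ⊆ _ from compl_subset_compl.2 inter_subset_right)
      (hnull k)
  have htop : ∑' k, potential (rieszKernel n α) (γ k) 0 = ⊤ := by
    by_contra hne
    refine hthin ⟨2, one_lt_two, ne_top_of_le_ne_top ?_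
      (ENNReal.tsum_le_tsum fun k => innerCap_div_le hαn (hann k) (hcap k))⟩
    rw [ENNReal.tsum_mul_left]
    exact ENNReal.mul_ne_top (ENNReal.mul_ne_top (ENNReal.mul_ne_top ENNReal.ofNat_ne_top hPt) hPt)
      hne
  refine ⟨P + 3, ENNReal.add_ne_top.2 ⟨hPt, ENNReal.ofNat_ne_top⟩, fun M => ?_⟩
  obtain ⟨N, hN⟩ := exists_one_le_sum_Ico (fun k => hle k 0) htop M
  set S := ∑ k ∈ Finset.Ico M N, potential (rieszKernel n α) (γ k) 0 with hS
  have hS0 : S ≠ 0 := (zero_lt_one.trans_le hN).ne'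
  have hSt : S ≠ ⊤ := ENNReal.sum_ne_top.2 fun k _ => ne_top_of_le_ne_top ENNReal.one_ne_top (hle k 0)
  have hσ : IsFiniteMeasure (∑ k ∈ Finset.Ico M N, γ k) := ⟨by
    rw [Measure.finsetSum_apply]
    exact ENNReal.sum_lt_top.2 fun k _ => measure_lt_top (γ k) _⟩
  have hnull' : ∀ T : Set (Rn n), (∀ k, M ≤ k → γ k T = 0) →
      (S⁻¹ • ∑ k ∈ Finset.Ico M N, γ k) T = 0 := by
    intro T hT
    rw [Measure.smul_apply, Measure.finsetSum_apply, smul_eq_mul]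
    exact mul_eq_zero_of_right _
      (Finset.sum_eq_zero fun k hk => hT k (Finset.mem_Ico.1 hk).1)
  refine ⟨S⁻¹ • ∑ k ∈ Finset.Ico M N, γ k, Measure.smul_finite _ (ENNReal.inv_ne_top.2 hS0),
    hnull' _ fun k _ => measure_mono_null (compl_subset_compl.2 inter_subset_left) (hnull k), ?_, ?_, fun x => ?_⟩
  · rw [ae_iff]
    refine hnull' _ fun k hk => ?_
    rw [← ae_iff]
    filter_upwards [hann k] with y hy
    exact (pow_le_pow_right₀ one_le_two hk).trans hy.1
  · rw [potential_smul, potential_finsetSum, ← hS, ENNReal.inv_mul_cancel hS0 hSt]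
  · rw [potential_smul, potential_finsetSum]
    have hterm : ∀ k, potential (rieszKernel n α) (γ k) x ≤
        P * potential (rieszKernel n α) (γ k) 0 +
          if ‖x‖ < 2 ^ (k + 2) ∧ (2 : ℝ) ^ k < 2 * ‖x‖ then 1 else 0 := by
      intro k
      split_ifs with h
      · exact (hle k x).trans le_add_self
      · exact (potential_le_of_dyadicAnnulus hαn (hann k) h).trans le_self_add
    calc S⁻¹ * ∑ k ∈ Finset.Ico M N, potential (rieszKernel n α) (γ k) x
        ≤ S⁻¹ * (P * S + 3) := by
          gcongr
          refine (Finset.sum_le_sum fun k _ => hterm k).trans ?_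
          rw [Finset.sum_add_distrib, ← Finset.mul_sum, Finset.sum_boole]
          gcongr
          exact_mod_cast card_filter_dyadic_le _ _
      _ = P * (S⁻¹ * S) + S⁻¹ * 3 := by ring
      _ ≤ P + 3 := by
          rw [ENNReal.inv_mul_cancel hS0 hSt, mul_one]
          gcongr
          exact mul_le_of_le_one_left zero_le (ENNReal.inv_le_one.2 hN)

lemma tendsto_potential_near_infinity (hαn : α < n) {τ : ℕ → Measure (Rn n)}
    (hτ : ∀ M, ∀ᵐ y ∂τ M, 2 ^ M ≤ ‖y‖) (h1 : ∀ M, potential (rieszKernel n α) (τ M) 0 = 1)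
    (x : Rn n) : Tendsto (fun M => potential (rieszKernel n α) (τ M) x) atTop (𝓝 1) := by
  have hr : Tendsto (fun M : ℕ => ‖x‖ / 2 ^ M) atTop (𝓝 0) :=
    tendsto_const_nhds.div_atTop (tendsto_pow_atTop_atTop_of_one_lt one_lt_two)
  have ht : Tendsto (fun M : ℕ => (1 - ‖x‖ / 2 ^ M)⁻¹) atTop (𝓝 1) := by
    have := (hr.const_sub 1).inv₀ (by norm_num)
    simpa using this
  have hup : Tendsto (fun M : ℕ => ENNReal.ofReal (1 - ‖x‖ / 2 ^ M)⁻¹ ^ ((n : ℝ) - α)) atTop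
      (𝓝 1) := by
    have := (ENNReal.tendsto_ofReal ht).ennrpow_const ((n : ℝ) - α)
    simpa using this
  have hlow : Tendsto (fun M : ℕ => (ENNReal.ofReal (1 - ‖x‖ / 2 ^ M)⁻¹ ^ ((n : ℝ) - α))⁻¹) atTop
      (𝓝 1) := by
    simpa using tendsto_inv_iff.2 hup
  have hev : ∀ᶠ M : ℕ in atTop, ‖x‖ / 2 ^ M < 1 := hr.eventually (gt_mem_nhds one_pos)
  have hdist : ∀ M : ℕ, ‖x‖ / 2 ^ M < 1 → ∀ y : Rn n, 2 ^ M ≤ ‖y‖ →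
      dist 0 y ≤ (1 - ‖x‖ / 2 ^ M)⁻¹ * dist x y ∧ dist x y ≤ (1 - ‖x‖ / 2 ^ M)⁻¹ * dist 0 y := by
    intro M hM y hy
    set r := ‖x‖ / 2 ^ M with hr
    have hr0 : 0 ≤ r := by positivity
    have hr1 : 0 < 1 - r := by linarith
    have hx : ‖x‖ ≤ r * ‖y‖ := by
      calc ‖x‖ = r * 2 ^ M := by rw [hr]; field_simp
        _ ≤ _ := by gcongr
    rw [dist_zero_left, dist_eq_norm, inv_mul_eq_div, inv_mul_eq_div, le_div_iff₀ hr1,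
      le_div_iff₀ hr1]
    have ha := norm_sub_norm_le y x
    rw [norm_sub_rev] at ha
    have hb := norm_sub_le x y
    have hy0 := norm_nonneg y
    constructor
    · nlinarith
    · have : ‖x - y‖ ≤ (1 + r) * ‖y‖ := by linarith
      calc ‖x - y‖ * (1 - r) ≤ (1 + r) * ‖y‖ * (1 - r) := by gcongr
        _ ≤ ‖y‖ := by nlinarith [mul_nonneg (mul_nonneg hr0 hr0) hy0]
  refine tendsto_of_tendsto_of_tendsto_of_le_of_le' hlow hup ?_ ?_
  · filter_upwards [hev] with M hM
    have hpos : 0 < (1 - ‖x‖ / 2 ^ M)⁻¹ := inv_pos.2 (by linarith)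
    have h := potential_le_of_dist_le hαn (μ := τ M) hpos (x := 0) (x' := x)
      ((hτ M).mono fun y hy => (hdist M hM y hy).2)
    rw [h1] at h
    rw [← one_div]
    exact ENNReal.div_le_of_le_mul' h
  · filter_upwards [hev] with M hM
    have hpos : 0 < (1 - ‖x‖ / 2 ^ M)⁻¹ := inv_pos.2 (by linarith)
    have h := potential_le_of_dist_le hαn (μ := τ M) hpos (x := x) (x' := 0)
      ((hτ M).mono fun y hy => (hdist M hM y hy).1)
    rwa [h1, mul_one] at h

lemma energy_le_mul_measure_univ {τ : Measure (Rn n)} [SFinite τ] {C : ℝ≥0∞}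
    (h : ∀ x, potential (rieszKernel n α) τ x ≤ C) :
    energy (rieszKernel n α) τ ≤ C * τ univ := by
  rw [energy, mutualEnergy_eq_lintegral_potential, ← lintegral_const]
  exact lintegral_mono h

/-- Balayage onto a set which is not thin at infinity preserves the total mass. -/
lemma IsInnerBalayage.measure_univ_eq (hαn : α < n) {A : Set (Rn n)}
    (hthin : ¬ InnerThinAtInfinity n α A) {ζ β : Measure (Rn n)} [IsFiniteMeasure ζ]
    (hβ : IsInnerBalayage (rieszKernel n α) A ζ β) : β univ = ζ univ := by
  obtain ⟨C, hC, hτ⟩ := exists_measure_near_infinity hαn hthin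
  choose τ hfin hnull hfar hone hle using hτ
  have := sFinite_of_isRadon hβ.1.1
  have hlim := tendsto_potential_near_infinity hαn hfar hone
  have hmeas : ∀ M, Measurable (potential (rieszKernel n α) (τ M)) :=
    fun M => measurable_potential (τ M)
  have heq : ∀ M, ∫⁻ x, potential (rieszKernel n α) (τ M) x ∂β =
      ∫⁻ x, potential (rieszKernel n α) (τ M) x ∂ζ := by
    intro M
    rw [← mutualEnergy_eq_lintegral_potential, ← mutualEnergy_eq_lintegral_potential,
      mutualEnergy_comm, hβ.mutualEnergy_eq (hnull M), mutualEnergy_comm]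
    exact ne_top_of_le_ne_top (ENNReal.mul_ne_top hC (measure_ne_top _ _))
      (energy_le_mul_measure_univ (hle M))
  have hmass : ∀ (ρ : Measure (Rn n)) [IsFiniteMeasure ρ],
      Tendsto (fun M => ∫⁻ x, potential (rieszKernel n α) (τ M) x ∂ρ) atTop (𝓝 (ρ univ)) := by
    intro ρ _
    rw [← one_mul (ρ univ), ← lintegral_const]
    refine tendsto_lintegral_of_dominated_convergence (fun _ => C) hmeas
      (fun M => ae_of_all _ (hle M)) ?_ (ae_of_all _ hlim)
    rw [lintegral_const]
    exact ENNReal.mul_ne_top hC (measure_ne_top _ _)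
  have hβfin : β univ ≤ ζ univ := by
    calc β univ = ∫⁻ x, liminf (fun M => potential (rieszKernel n α) (τ M) x) atTop ∂β := by
          simp_rw [fun x => (hlim x).liminf_eq]
          simp
      _ ≤ liminf (fun M => ∫⁻ x, potential (rieszKernel n α) (τ M) x ∂β) atTop :=
          lintegral_liminf_le hmeas
      _ = ζ univ := by
          simp_rw [heq]
          exact (hmass ζ).liminf_eq
  have : IsFiniteMeasure β := ⟨hβfin.trans_lt (measure_lt_top ζ _)⟩
  refine tendsto_nhds_unique (hmass β) ?_
  simp_rw [heq]
  exact hmass ζ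

/-- A set which is not thin at infinity carries probability measures of arbitrarily small energy. -/
lemma exists_memBreve_energy_lt (hαn : α < n) {A : Set (Rn n)}
    (hthin : ¬ InnerThinAtInfinity n α A) {ε : ℝ≥0∞} (hε : ε ≠ 0) :
    ∃ τ : Measure (Rn n), memBreve (rieszKernel n α) A τ ∧ energy (rieszKernel n α) τ < ε := by
  obtain ⟨C, hC, hτ⟩ := exists_measure_near_infinity hαn hthin
  have hlim : Tendsto (fun M : ℕ => C * ENNReal.ofReal (2 ^ M) ^ (α - (n : ℝ))) atTop (𝓝 0) := by
    have h1 : Tendsto (fun M : ℕ => (2 : ℝ) ^ M) atTop atTop :=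
      tendsto_pow_atTop_atTop_of_one_lt one_lt_two
    have h2 := (tendsto_rpow_neg_atTop (show 0 < (n : ℝ) - α by linarith)).comp h1
    have h3 := ENNReal.Tendsto.const_mul (a := C) (ENNReal.tendsto_ofReal h2) (Or.inr hC)
    rw [ENNReal.ofReal_zero, mul_zero] at h3
    refine h3.congr fun M => ?_
    rw [Function.comp_apply, ENNReal.ofReal_rpow_of_pos (by positivity), neg_sub]
  obtain ⟨M, hM⟩ := (hlim.eventually (gt_mem_nhds (pos_iff_ne_zero.2 hε))).exists
  obtain ⟨τ, hfin, hnull, hfar, hone, hle⟩ := hτ M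
  have hmass : 1 ≤ ENNReal.ofReal (2 ^ M) ^ (α - (n : ℝ)) * τ univ := by
    rw [← hone, ← lintegral_const]
    refine lintegral_mono_ae ?_
    filter_upwards [hfar] with y hy
    exact rieszKernel_le_of_le_dist hαn (by rwa [dist_zero_left])
  have h0 : τ univ ≠ 0 := fun h => by simp [h] at hmass
  have ht : τ univ ≠ ⊤ := measure_ne_top _ _
  have hinv : (τ univ)⁻¹ ≤ ENNReal.ofReal (2 ^ M) ^ (α - (n : ℝ)) := by
    rw [← one_div]
    exact ENNReal.div_le_of_le_mul hmass
  have hfin' : IsFiniteMeasure ((τ univ)⁻¹ • τ) :=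
    Measure.smul_finite _ (ENNReal.inv_ne_top.2 h0)
  have hE : energy (rieszKernel n α) ((τ univ)⁻¹ • τ) < ε := by
    rw [energy_smul]
    refine lt_of_le_of_lt ?_ hM
    calc (τ univ)⁻¹ ^ 2 * energy (rieszKernel n α) τ
        ≤ (τ univ)⁻¹ ^ 2 * (C * τ univ) := by gcongr; exact energy_le_mul_measure_univ hle
      _ = C * ((τ univ)⁻¹ * ((τ univ)⁻¹ * τ univ)) := by ring
      _ = C * (τ univ)⁻¹ := by rw [ENNReal.inv_mul_cancel h0 ht, mul_one]
      _ ≤ _ := by gcongr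
  refine ⟨(τ univ)⁻¹ • τ, ⟨⟨isRadon_of_isFiniteMeasure _, hE.trans_le le_top⟩,
    concentrated_of_measure_compl_eq_zero ?_, ?_⟩, hE⟩
  · rw [Measure.smul_apply, hnull, smul_zero]
  · rw [Measure.smul_apply, smul_eq_mul, ENNReal.inv_mul_cancel h0 ht]

end Escaping

section GaussProblem

variable {n : ℕ} {α : ℝ}

lemma memEplus.mutualEnergy_ne_top (hαn : α < n) {μ ν : Measure (Rn n)}
    (hμ : memEplus (rieszKernel n α) μ) (hν : memEplus (rieszKernel n α) ν) :
    mutualEnergy (rieszKernel n α) μ ν ≠ ⊤ := by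
  have h := (energyPrinciple_rieszKernel hαn μ ν hμ hν).1
  refine ne_top_of_le_ne_top (ENNReal.add_ne_top.2 ⟨hμ.2.ne, hν.2.ne⟩) (le_trans ?_ h)
  rw [two_mul]
  exact le_self_add

variable {A : Set (Rn n)} {ζ β : Measure (Rn n)} {f : Rn n → EReal}

lemma memBreve.isFiniteMeasure {μ : Measure (Rn n)} (hμ : memBreve (rieszKernel n α) A μ) :
    IsFiniteMeasure μ := ⟨by rw [hμ.2.2]; exact ENNReal.one_lt_top⟩

/-- For `f = -U^ζ` the Gauss functional of a measure on `A` is expressed through the balayage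
of `ζ` onto `A`. -/
lemma gaussI_eq (hαn : α < n) [SFinite ζ]
    (hf : ∀ x, f x = -((potential (rieszKernel n α) ζ x : ℝ≥0∞) : EReal))
    (hβ : IsInnerBalayage (rieszKernel n α) A ζ β) {μ : Measure (Rn n)}
    (hμ : memBreve (rieszKernel n α) A μ) :
    FieldIntegrable f μ ∧ gaussI (rieszKernel n α) f μ = (energy (rieszKernel n α) μ).toReal -
      2 * (mutualEnergy (rieszKernel n α) μ β).toReal := by
  have := hμ.isFiniteMeasure
  have hint : ∫⁻ x, potential (rieszKernel n α) ζ x ∂μ = mutualEnergy (rieszKernel n α) μ β := by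
    rw [← mutualEnergy_eq_lintegral_potential,
      hβ.mutualEnergy_eq hμ.2.1.measure_compl_eq_zero hμ.1.2.ne]
  have hne : ∫⁻ x, potential (rieszKernel n α) ζ x ∂μ ≠ ⊤ :=
    hint ▸ hμ.1.mutualEnergy_ne_top hαn hβ.1
  have hmeas : Measurable (potential (rieszKernel n α) ζ) := measurable_potential ζ
  have hfin := ae_lt_top hmeas hne
  have hreal : (fun x => (f x).toReal) = fun x => -(potential (rieszKernel n α) ζ x).toReal := by
    ext x
    rw [hf, EReal.toReal_neg_eq, EReal.toReal_coe_ennreal]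
  refine ⟨⟨?_, ?_⟩, ?_⟩
  · rw [hreal]
    exact (integrable_toReal_of_lintegral_ne_top hmeas.aemeasurable hne).neg
  · filter_upwards [hfin] with x hx
    rw [hf]
    simp [hx.ne]
  · rw [gaussI, fieldIntegral, hreal, integral_neg, integral_toReal hmeas.aemeasurable hfin, hint]
    ring

lemma neg_energy_le_gaussI (hαn : α < n) [SFinite ζ]
    (hf : ∀ x, f x = -((potential (rieszKernel n α) ζ x : ℝ≥0∞) : EReal))
    (hβ : IsInnerBalayage (rieszKernel n α) A ζ β) {μ : Measure (Rn n)}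
    (hμ : memBreve (rieszKernel n α) A μ) :
    -(energy (rieszKernel n α) β).toReal ≤ gaussI (rieszKernel n α) f μ ∧
      (gaussI (rieszKernel n α) f μ ≤ -(energy (rieszKernel n α) β).toReal → μ = β) := by
  obtain ⟨hle, heq⟩ := energyPrinciple_rieszKernel hαn μ β hμ.1 hβ.1
  have hm := hμ.1.mutualEnergy_ne_top hαn hβ.1
  have hl : 2 * mutualEnergy (rieszKernel n α) μ β ≠ ⊤ :=
    ENNReal.mul_ne_top ENNReal.ofNat_ne_top hm
  have hr := ENNReal.add_ne_top.2 ⟨hμ.1.2.ne, hβ.1.2.ne⟩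
  have htwo : (2 * mutualEnergy (rieszKernel n α) μ β).toReal =
      2 * (mutualEnergy (rieszKernel n α) μ β).toReal := by simp
  have hadd := ENNReal.toReal_add hμ.1.2.ne hβ.1.2.ne
  have hreal := ENNReal.toReal_mono hr hle
  rw [(gaussI_eq hαn hf hβ hμ).2]
  refine ⟨by linarith, fun h => heq ?_⟩
  rw [← ENNReal.toReal_eq_toReal_iff' hl hr]
  linarith

lemma memBreve_of_balayage (hβ : IsInnerBalayage (rieszKernel n α) A ζ β) (h : β univ = 1) :
    memBreve (rieszKernel n α) A β := ⟨hβ.1, hβ.2.1, h⟩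

lemma gaussI_balayage (hαn : α < n) [SFinite ζ]
    (hf : ∀ x, f x = -((potential (rieszKernel n α) ζ x : ℝ≥0∞) : EReal))
    (hβ : IsInnerBalayage (rieszKernel n α) A ζ β) (h : memBreve (rieszKernel n α) A β) :
    gaussI (rieszKernel n α) f β = -(energy (rieszKernel n α) β).toReal := by
  rw [(gaussI_eq hαn hf hβ h).2, ← energy]
  ring

/-- Filling up the missing mass of the balayage with measures of small energy, one sees that the
lower bound `-I(β)` for the Gauss functional is sharp. -/
lemma exists_gaussI_lt (hαn : α < n) (hthin : ¬ InnerThinAtInfinity n α A)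
    [IsFiniteMeasure ζ] (hζ1 : ζ univ ≤ 1)
    (hf : ∀ x, f x = -((potential (rieszKernel n α) ζ x : ℝ≥0∞) : EReal))
    (hβ : IsInnerBalayage (rieszKernel n α) A ζ β) {ε : ℝ} (hε : 0 < ε) :
    ∃ μ : Measure (Rn n), Admissible (rieszKernel n α) A f μ ∧
      gaussI (rieszKernel n α) f μ < -(energy (rieszKernel n α) β).toReal + ε := by
  obtain ⟨τ, hτ, hτε⟩ := exists_memBreve_energy_lt hαn hthin (ENNReal.ofReal_pos.2 hε).ne'
  have := hτ.isFiniteMeasure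
  have hmass : β univ = ζ univ := hβ.measure_univ_eq hαn hthin
  have : IsFiniteMeasure β := ⟨hmass ▸ measure_lt_top ζ _⟩
  set δ := 1 - ζ univ with hδ
  have hδ1 : δ ≤ 1 := tsub_le_self
  have hδt : δ ≠ ⊤ := ne_top_of_le_ne_top ENNReal.one_ne_top hδ1
  have : IsFiniteMeasure (δ • τ) := Measure.smul_finite _ hδt
  have hm := hτ.1.mutualEnergy_ne_top hαn hβ.1
  have hδm : δ * mutualEnergy (rieszKernel n α) τ β ≠ ⊤ := ENNReal.mul_ne_top hδt hm
  have hδe : δ ^ 2 * energy (rieszKernel n α) τ ≠ ⊤ :=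
    ENNReal.mul_ne_top (ENNReal.pow_ne_top hδt) hτ.1.2.ne
  have hE : energy (rieszKernel n α) (β + δ • τ) = energy (rieszKernel n α) β +
      2 * (δ * mutualEnergy (rieszKernel n α) τ β) + δ ^ 2 * energy (rieszKernel n α) τ := by
    rw [energy_add, energy_smul, mutualEnergy_smul_left]
  have hM : mutualEnergy (rieszKernel n α) (β + δ • τ) β = energy (rieszKernel n α) β +
      δ * mutualEnergy (rieszKernel n α) τ β := by
    rw [mutualEnergy_add_left, mutualEnergy_smul_left, energy]
  have h2 : 2 * (δ * mutualEnergy (rieszKernel n α) τ β) ≠ ⊤ :=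
    ENNReal.mul_ne_top ENNReal.ofNat_ne_top hδm
  have hμ : memBreve (rieszKernel n α) A (β + δ • τ) := by
    refine ⟨⟨isRadon_of_isFiniteMeasure _, ?_⟩, concentrated_of_measure_compl_eq_zero ?_, ?_⟩
    · rw [hE]
      exact (ENNReal.add_ne_top.2 ⟨ENNReal.add_ne_top.2 ⟨hβ.1.2.ne, h2⟩, hδe⟩).lt_top
    · simp [hβ.2.1.measure_compl_eq_zero, hτ.2.1.measure_compl_eq_zero]
    · rw [Measure.add_apply, Measure.smul_apply, hτ.2.2, smul_eq_mul, mul_one, hmass, hδ,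
        add_tsub_cancel_of_le hζ1]
  obtain ⟨hint, hG⟩ := gaussI_eq hαn hf hβ hμ
  refine ⟨β + δ • τ, ⟨hμ, hint⟩, ?_⟩
  have hsmall : (δ ^ 2 * energy (rieszKernel n α) τ).toReal < ε := by
    rw [← ENNReal.lt_ofReal_iff_toReal_lt hδe]
    exact (mul_le_of_le_one_left zero_le (pow_le_one₀ zero_le hδ1)).trans_lt hτε
  have hEr := congrArg ENNReal.toReal hE
  have hMr := congrArg ENNReal.toReal hM
  rw [ENNReal.toReal_add (ENNReal.add_ne_top.2 ⟨hβ.1.2.ne, h2⟩) hδe,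
    ENNReal.toReal_add hβ.1.2.ne h2, ENNReal.toReal_mul (a := 2), ENNReal.toReal_ofNat] at hEr
  rw [ENNReal.toReal_add hβ.1.2.ne hδm] at hMr
  rw [hG]
  linarith

lemma IsSolution.gaussI_le {κ : X → X → ℝ≥0∞} {A : Set X} {f : X → EReal} {l μ : Measure X}
    (hl : IsSolution κ A f l) (hμ : Admissible κ A f μ) : gaussI κ f l ≤ gaussI κ f μ := by
  rw [← EReal.coe_le_coe_iff, hl.2]
  exact iInf₂_le μ hμ

end GaussProblem

theorem stmt14 (n : ℕ) (hn : 2 ≤ n) (α : ℝ) (hα0 : 0 < α) (hαn : α < n) (hα2 : α ≤ 2)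
    (A : Set (Rn n)) (ζ β : Measure (Rn n)) (f : Rn n → EReal)
    (hclosed : StrongClosedEplusOn (rieszKernel n α) A)
    (hcap0 : innerCap (rieszKernel n α) A ≠ 0)
    (hthin : ¬ InnerThinAtInfinity n α A)
    (hζ : memEplus (rieszKernel n α) ζ) (hζ1 : ζ Set.univ ≤ 1)
    (hf : ∀ x, f x = -((potential (rieszKernel n α) ζ x : ℝ≥0∞) : EReal))
    (hβ : IsInnerBalayage (rieszKernel n α) A ζ β) :
    ((∃ l : Measure (Rn n), IsSolution (rieszKernel n α) A f l) ↔ ζ Set.univ = 1) ∧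
    ∀ l : Measure (Rn n), IsSolution (rieszKernel n α) A f l → l = β := by
  have : IsFiniteMeasure ζ := ⟨hζ1.trans_lt ENNReal.one_lt_top⟩
  have hmass : β univ = ζ univ := hβ.measure_univ_eq hαn hthin
  have huniq : ∀ l : Measure (Rn n), IsSolution (rieszKernel n α) A f l → l = β := by
    intro l hl
    refine (neg_energy_le_gaussI hαn hf hβ hl.1.1).2 (le_of_forall_pos_le_add fun ε hε => ?_)
    obtain ⟨μ, hμ, hμε⟩ := exists_gaussI_lt hαn hthin hζ1 hf hβ hε
    exact (hl.gaussI_le hμ).trans hμε.le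
  refine ⟨⟨?_, fun h => ?_⟩, huniq⟩
  · rintro ⟨l, hl⟩
    rw [← hmass, ← huniq l hl]
    exact hl.1.1.2.2
  · have hB : memBreve (rieszKernel n α) A β := memBreve_of_balayage hβ (hmass.trans h)
    have hadm : Admissible (rieszKernel n α) A f β := ⟨hB, (gaussI_eq hαn hf hβ hB).1⟩
    refine ⟨β, hadm, le_antisymm (le_iInf₂ fun μ hμ => ?_) (iInf₂_le β hadm)⟩
    rw [EReal.coe_le_coe_iff, gaussI_balayage hαn hf hβ hB]
    exact (neg_energy_le_gaussI hαn hf hβ hμ.1).1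

end GaussVar
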